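/- (Balanced supersaturation for Erdős–Simonovits good graphs) Let H be a bipartite graph with h vertices and ℓ edges, and suppose H is Erdős–Simonovits good. Let α and A be positive reals satisfying A ≥ 16, α > 2 − 1/m₂(H), and ex(n,H) ≤ A·n^α for all n. Then there exist constants δ_H, k₀, C > 0 such that the following holds. Let G be an n-vertex graph with k·n^α edges where k ≥ k₀. Then G contains a family 𝓗 of copies of H satisfying: (1) |𝓗| ≥ δ_H·e(G)^ℓ / n^{2ℓ−h}; and (2) for every S ⊆ E(G) with 1 ≤ |S| ≤ ℓ, d_𝓗(S) ≤ C·β^{|S|−1}·|𝓗|/e(G), where β = max{ (1/k)·n^{−φ(α,H)}, k^{−λ*(α,H)} }, φ(α,H) = (αℓ − α + h − 2ℓ)/(ℓ−1), and λ*(α,H) = 1/(m*₂(H)(2−α)). -/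

import Mathlib

set_option autoImplicit false

open Finset Filter MeasureTheory

/-- `G` is an `r`-uniform hypergraph: every edge has exactly `r` vertices. -/
def UniformHG (r : ℕ) {V : Type*} (G : Finset (Finset V)) : Prop :=
  ∀ e ∈ G, e.card = r

/-- The set of vertices spanned by an edge set. -/
def vertsHG {V : Type*} [DecidableEq V] (G : Finset (Finset V)) : Finset V :=
  G.biUnion id

/-- `A` is (the edge set of) a copy of `H` in `G`. -/
def IsCopy {V W : Type*} [DecidableEq V] [DecidableEq W]
    (H : Finset (Finset V)) (G : Finset (Finset W)) (A : Finset (Finset W)) : Prop :=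
  ∃ f : V → W, Function.Injective f ∧ A = H.image (fun e => e.image f) ∧ A ⊆ G

/-- The set of copies of `H` in `G`, each copy identified with its edge set. -/
def copies {V W : Type*} [DecidableEq V] [DecidableEq W]
    (H : Finset (Finset V)) (G : Finset (Finset W)) : Set (Finset (Finset W)) :=
  {A | IsCopy H G A}

/-- `G` contains no copy of `H`. -/
def HFree {V W : Type*} [DecidableEq V] [DecidableEq W]
    (H : Finset (Finset V)) (G : Finset (Finset W)) : Prop :=
  ∀ A, ¬ IsCopy H G A

/-- The extremal number `ex(n, H)`: the maximum number of edges in an `H`-free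
`r`-uniform hypergraph on `n` vertices. -/
noncomputable def exN {V : Type*} [DecidableEq V] (r : ℕ) (H : Finset (Finset V)) (n : ℕ) : ℕ :=
  sSup {m | ∃ G : Finset (Finset (Fin n)), UniformHG r G ∧ HFree H G ∧ G.card = m}

/-- The degree `d_F(S)` of an edge set `S` in a family `F` of copies. -/
def degF {W : Type*} [DecidableEq W]
    (F : Finset (Finset (Finset W))) (S : Finset (Finset W)) : ℕ :=
  (F.filter fun B => S ⊆ B).card

/-- `H` is `r`-partite: the vertices can be `r`-colored so that every edge meets each
color class in exactly one vertex. -/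
def MultipartiteHG (r : ℕ) {V : Type*} (H : Finset (Finset V)) : Prop :=
  ∃ c : V → Fin r, ∀ e ∈ H, ∀ i : Fin r, ∃! v, v ∈ e ∧ c v = i

/-- The `r`-density `m_r(H)`. -/
noncomputable def mDen (r : ℕ) {V : Type*} [DecidableEq V] (H : Finset (Finset V)) : ℝ :=
  sSup {x : ℝ | ∃ F, F ⊆ H ∧ r < (vertsHG F).card ∧
    x = ((F.card : ℝ) - 1) / (((vertsHG F).card : ℝ) - (r : ℝ))}

/-- The proper `r`-density `m*_r(H)`. -/
noncomputable def mDenStar (r : ℕ) {V : Type*} [DecidableEq V] (H : Finset (Finset V)) : ℝ :=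
  sSup {x : ℝ | ∃ F, F ⊂ H ∧ r < (vertsHG F).card ∧
    x = ((F.card : ℝ) - 1) / (((vertsHG F).card : ℝ) - (r : ℝ))}

/-- `λ(α,H) = 1/(m_r(H)(r−α))`. -/
noncomputable def lamHG (r : ℕ) {V : Type*} [DecidableEq V] (α : ℝ) (H : Finset (Finset V)) : ℝ :=
  1 / (mDen r H * ((r : ℝ) - α))

/-- `λ*(α,H) = 1/(m*_r(H)(r−α))`. -/
noncomputable def lamStarHG (r : ℕ) {V : Type*} [DecidableEq V] (α : ℝ) (H : Finset (Finset V)) : ℝ :=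
  1 / (mDenStar r H * ((r : ℝ) - α))

/-- `φ(α,H) = (αℓ − α + h − 2ℓ)/(ℓ−1)` for a graph with `h` vertices and `ℓ` edges. -/
noncomputable def phiHG (α : ℝ) (h ℓ : ℕ) : ℝ :=
  (α * (ℓ : ℝ) - α + (h : ℝ) - 2 * (ℓ : ℝ)) / ((ℓ : ℝ) - 1)

/-- `H` (a graph on `h` vertices) is Erdős–Simonovits good for the exponent `α`. -/
def ESGood {h : ℕ} (H : Finset (Finset (Fin h))) (α : ℝ) : Prop :=
  ∃ C c : ℝ, 0 < C ∧ 0 < c ∧ ∀ᶠ n : ℕ in Filter.atTop,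
    ∀ G : Finset (Finset (Fin n)), UniformHG 2 G → C * (n : ℝ) ^ α < (G.card : ℝ) →
      c * (G.card : ℝ) ^ H.card / (n : ℝ) ^ ((2 * H.card : ℝ) - (h : ℝ)) ≤
        ((copies H G).ncard : ℝ)

theorem vertsHG_image {V W : Type*} [DecidableEq V] [DecidableEq W] (F : Finset (Finset V))
    (f : V → W) : vertsHG (F.image fun e => e.image f) = (vertsHG F).image f := by
  ext w
  simp only [vertsHG, mem_biUnion, mem_image, id]
  constructor
  · rintro ⟨_, ⟨e, he, rfl⟩, hw⟩
    obtain ⟨v, hv, rfl⟩ := mem_image.1 hw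
    exact ⟨v, ⟨e, he, hv⟩, rfl⟩
  · rintro ⟨v, ⟨e, he, hv⟩, rfl⟩
    exact ⟨_, ⟨e, he, rfl⟩, mem_image_of_mem f hv⟩

theorem vertsHG_subset_iff {V : Type*} [DecidableEq V] {F : Finset (Finset V)} {U : Finset V} :
    vertsHG F ⊆ U ↔ ∀ e ∈ F, e ⊆ U := by
  simp [vertsHG]

theorem vertsHG_mono {V : Type*} [DecidableEq V] {F F' : Finset (Finset V)} (h : F ⊆ F') :
    vertsHG F ⊆ vertsHG F' := Finset.biUnion_subset_biUnion_of_subset_left _ h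

theorem IsCopy.mono {V W : Type*} [DecidableEq V] [DecidableEq W] {H : Finset (Finset V)}
    {G G' A : Finset (Finset W)} (hA : IsCopy H G A) (h : G ⊆ G') : IsCopy H G' A := by
  obtain ⟨f, hf, hAe, hAG⟩ := hA
  exact ⟨f, hf, hAe, hAG.trans h⟩

theorem IsCopy.card_eq {V W : Type*} [DecidableEq V] [DecidableEq W] {H : Finset (Finset V)}
    {G A : Finset (Finset W)} (hA : IsCopy H G A) : A.card = H.card := by
  obtain ⟨f, hf, rfl, -⟩ := hA
  exact card_image_of_injective _ (image_injective hf)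

/-- Every subset of a copy of `H` is a copy of a subset of `H`. -/
theorem IsCopy.exists_subset {V W : Type*} [DecidableEq V] [DecidableEq W] {H : Finset (Finset V)}
    {G A S : Finset (Finset W)} (hA : IsCopy H G A) (hS : S ⊆ A) :
    ∃ F ⊆ H, F.card = S.card ∧ (vertsHG F).card = (vertsHG S).card := by
  obtain ⟨f, hf, rfl, -⟩ := hA
  have hSF : S = (H.filter fun e => e.image f ∈ S).image (fun e => e.image f) := by
    ext e
    simp only [mem_image, mem_filter]
    constructor
    · intro he
      obtain ⟨e', he', rfl⟩ := mem_image.1 (hS he)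
      exact ⟨e', ⟨he', he⟩, rfl⟩
    · rintro ⟨e', ⟨-, he'⟩, rfl⟩
      exact he'
  refine ⟨H.filter fun e => e.image f ∈ S, filter_subset _ _, ?_, ?_⟩
  · conv_rhs => rw [hSF]
    exact (card_image_of_injective _ (image_injective hf)).symm
  · conv_rhs => rw [hSF, vertsHG_image]
    exact (card_image_of_injective _ hf).symm

/-- A copy of a graph without isolated vertices on `h` vertices spans `h` vertices. -/
theorem IsCopy.card_vertsHG {h : ℕ} {W : Type*} [DecidableEq W] {H : Finset (Finset (Fin h))}
    (hcov : ∀ v : Fin h, ∃ e ∈ H, v ∈ e) {G A : Finset (Finset W)} (hA : IsCopy H G A) :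
    (vertsHG A).card = h := by
  obtain ⟨f, hf, rfl, -⟩ := hA
  have : vertsHG H = univ := by
    ext v
    simpa [vertsHG] using hcov v
  rw [vertsHG_image, card_image_of_injective _ hf, this, card_univ, Fintype.card_fin]

/-- Counting copies of `H` in a graph supported on the range of an embedding: it is enough to
count copies in the pulled back graph. -/
theorem exists_pullback {V W X : Type*} [DecidableEq V] [DecidableEq W] [DecidableEq X] [Fintype X]
    [Fintype W] (H : Finset (Finset V)) {r : ℕ} {G : Finset (Finset W)} (hG : UniformHG r G)
    (φ : X → W) (hφ : Function.Injective φ) (hsupp : ∀ e ∈ G, (e : Set W) ⊆ Set.range φ) :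
    ∃ G' : Finset (Finset X), UniformHG r G' ∧ G'.card = G.card ∧
      (copies H G').ncard ≤ (copies H G).ncard := by
  classical
  set G' : Finset (Finset X) := univ.filter fun e => e.image φ ∈ G with hG'
  have himg : G'.image (fun e => e.image φ) = G := by
    ext e
    simp only [hG', mem_image, mem_filter, mem_univ, true_and]
    constructor
    · rintro ⟨e', he', rfl⟩
      exact he'
    · intro he
      obtain ⟨e', he'⟩ : ∃ e' : Finset X, e'.image φ = e := by
        have : e ⊆ univ.image φ := by
          intro w hw
          obtain ⟨x, rfl⟩ := hsupp e he hw
          exact mem_image_of_mem _ (mem_univ _)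
        obtain ⟨e', -, he'⟩ := Finset.subset_image_iff.1 this
        exact ⟨e', he'⟩
      exact ⟨e', he'.symm ▸ he, he'⟩
  have hinj : Function.Injective fun e : Finset X => e.image φ := image_injective hφ
  refine ⟨G', ?_, ?_, ?_⟩
  · intro e he
    have := hG _ (mem_filter.1 he).2
    rwa [card_image_of_injective _ hφ] at this
  · rw [← himg, card_image_of_injective _ hinj]
  · refine Set.ncard_le_ncard_of_injOn (fun A => A.image fun e => e.image φ) ?_
      (image_injective hinj).injOn (Set.toFinite _)
    rintro A ⟨f, hf, rfl, hA⟩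
    refine ⟨φ ∘ f, hφ.comp hf, ?_, ?_⟩
    · simp only [image_image, Function.comp_def]
    · rw [← himg]
      exact image_subset_image hA

/-- The number of `m`-subsets of an `n`-set containing a fixed `v`-subset. -/
def supersetCount (n m v : ℕ) : ℕ := if v ≤ m then (n - v).choose (m - v) else 0

theorem card_filter_superset {n : ℕ} (m : ℕ) (T : Finset (Fin n)) :
    ((powersetCard m (univ : Finset (Fin n))).filter (T ⊆ ·)).card
      = supersetCount n m T.card := by
  unfold supersetCount
  split_ifs with h
  · have := card_filter_powersetCard_subset T (univ : Finset (Fin n)) m (subset_univ _) h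
    simpa using this
  · rw [card_eq_zero, filter_eq_empty_iff]
    intro U hU hTU
    exact h ((card_le_card hTU).trans_eq (mem_powersetCard.1 hU).2)

theorem supersetCount_succ {n m v : ℕ} (hvn : v < n) :
    (supersetCount n m (v + 1) : ℝ) * (n - v) = supersetCount n m v * (m - v) := by
  unfold supersetCount
  rcases lt_trichotomy v m with h | rfl | h
  · rw [if_pos (by omega), if_pos h.le]
    obtain ⟨a, rfl⟩ := Nat.exists_eq_add_of_lt h
    obtain ⟨b, rfl⟩ := Nat.exists_eq_add_of_lt hvn
    have := Nat.add_one_mul_choose_eq b a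
    rw [show v + b + 1 - (v + 1) = b by omega, show v + a + 1 - (v + 1) = a by omega,
      show v + b + 1 - v = b + 1 by omega, show v + a + 1 - v = a + 1 by omega]
    have h2 : ((b : ℝ) + 1) * b.choose a = (b + 1).choose (a + 1) * (a + 1) := by
      exact_mod_cast this
    push_cast
    linarith
  · simp
  · rw [if_neg (by omega), if_neg (by omega)]
    simp

theorem supersetCount_succ_le {n m v : ℕ} (hmn : m ≤ n) (hvn : v < n) :
    (supersetCount n m (v + 1) : ℝ) ≤ (m / n : ℝ) * supersetCount n m v := by
  have h1 := supersetCount_succ (m := m) hvn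
  have hv : (0 : ℝ) < n - v := sub_pos.2 (by exact_mod_cast hvn)
  have hn : (0 : ℝ) < n := by exact_mod_cast (Nat.zero_le v).trans_lt hvn
  have hmn' : (m : ℝ) ≤ n := by exact_mod_cast hmn
  have hc : (0 : ℝ) ≤ supersetCount n m v := Nat.cast_nonneg _
  have hv0 : (0 : ℝ) ≤ v := Nat.cast_nonneg _
  rw [← mul_le_mul_iff_of_pos_right hv, h1, div_mul_eq_mul_div, div_mul_eq_mul_div, le_div_iff₀ hn]
  nlinarith [mul_nonneg hc (mul_nonneg hv0 (sub_nonneg.2 hmn'))]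

theorem supersetCount_add_le {n m v : ℕ} (hmn : m ≤ n) (j : ℕ) (hvn : v + j ≤ n) :
    (supersetCount n m (v + j) : ℝ) ≤ (m / n : ℝ) ^ j * supersetCount n m v := by
  induction j with
  | zero => simp
  | succ j ih =>
    calc (supersetCount n m (v + (j + 1)) : ℝ)
        ≤ (m / n : ℝ) * supersetCount n m (v + j) := supersetCount_succ_le (v := v + j) hmn (by omega)
      _ ≤ (m / n : ℝ) * ((m / n : ℝ) ^ j * supersetCount n m v) := by
          gcongr
          exact ih (by omega)
      _ = _ := by ring

theorem le_supersetCount_two {n m : ℕ} (hm : 2 ≤ m) (hmn : m ≤ n) :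
    (m / n : ℝ) ^ 2 / 2 * supersetCount n m 0 ≤ supersetCount n m 2 := by
  have h0 := supersetCount_succ (n := n) (m := m) (v := 0) (by omega)
  have h1 := supersetCount_succ (n := n) (m := m) (v := 1) (by omega)
  have hm' : (2 : ℝ) ≤ m := by exact_mod_cast hm
  have hmn' : (m : ℝ) ≤ n := by exact_mod_cast hmn
  norm_num at h0 h1
  have hc : (0 : ℝ) ≤ supersetCount n m 0 := Nat.cast_nonneg _
  have hn : (0 : ℝ) < n := by linarith
  have hn1 : (0 : ℝ) < n - 1 := by linarith
  have e1 : (supersetCount n m 1 : ℝ) = supersetCount n m 0 * m / n := by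
    rw [eq_div_iff hn.ne', h0]
  have e2 : (supersetCount n m 2 : ℝ) = supersetCount n m 0 * m / n * (m - 1) / (n - 1) := by
    rw [eq_div_iff hn1.ne', h1, e1]
  rw [e2]
  have key : (m : ℝ) / n / 2 ≤ (m - 1) / (n - 1) := by
    rw [div_div, div_le_div_iff₀ (by positivity) hn1]
    nlinarith
  calc (m / n : ℝ) ^ 2 / 2 * supersetCount n m 0
      = supersetCount n m 0 * m / n * (m / n / 2) := by ring
    _ ≤ supersetCount n m 0 * m / n * ((m - 1) / (n - 1)) := by gcongr
    _ = _ := by ring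

theorem sum_card_filter_vertsHG_subset {n : ℕ} (m : ℕ) (F : Finset (Finset (Finset (Fin n)))) :
    ∑ U ∈ powersetCard m (univ : Finset (Fin n)), (F.filter fun S => vertsHG S ⊆ U).card
      = ∑ S ∈ F, supersetCount n m (vertsHG S).card := by
  have := sum_card_bipartiteAbove_eq_sum_card_bipartiteBelow
    (s := powersetCard m (univ : Finset (Fin n))) (t := F) (fun U S => vertsHG S ⊆ U)
  simp only [bipartiteAbove, bipartiteBelow] at this
  rw [this]
  exact sum_congr rfl fun S _ => card_filter_superset m _

theorem sum_card_filter_edge_subset {n : ℕ} (m : ℕ) (G : Finset (Finset (Fin n)))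
    (hG : UniformHG 2 G) :
    ∑ U ∈ powersetCard m (univ : Finset (Fin n)), (G.filter fun e => e ⊆ U).card
      = G.card * supersetCount n m 2 := by
  have := sum_card_bipartiteAbove_eq_sum_card_bipartiteBelow
    (s := powersetCard m (univ : Finset (Fin n))) (t := G) (fun U e => e ⊆ U)
  simp only [bipartiteAbove, bipartiteBelow] at this
  rw [this, ← smul_eq_mul, ← sum_const]
  exact sum_congr rfl fun e he => by rw [card_filter_superset, hG e he]

theorem two_le_card_vertsHG {W : Type*} [DecidableEq W] {G S : Finset (Finset W)}
    (hG : UniformHG 2 G) (hS : S ⊆ G) (hne : S.Nonempty) : 2 ≤ (vertsHG S).card := by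
  obtain ⟨e, he⟩ := hne
  rw [← hG e (hS he)]
  exact card_le_card (vertsHG_subset_iff.1 (Subset.refl (vertsHG S)) e he)

/-- Deleting one edge from every member of `𝒮` inside `U` and applying the counting hypothesis
on `m` vertices yields many copies of `H` inside `U` that contain no member of `𝒮`. -/
theorem card_good_copies_inside {h n m : ℕ} (H : Finset (Finset (Fin h))) (hH : H.Nonempty)
    {c T M : ℝ} (hc : 0 < c) (hT : 0 ≤ T) (hM : 0 < M)
    (hcount : ∀ G' : Finset (Finset (Fin m)), UniformHG 2 G' → T < (G'.card : ℝ) →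
      c * (G'.card : ℝ) ^ H.card / M ≤ ((copies H G').ncard : ℝ))
    (G : Finset (Finset (Fin n))) (hG : UniformHG 2 G)
    (𝒮 : Finset (Finset (Finset (Fin n)))) (h𝒮 : ∀ S ∈ 𝒮, S.Nonempty)
    (good : Finset (Finset (Finset (Fin n))))
    (hgood : ∀ B, IsCopy H G B → (∀ S ∈ 𝒮, ¬ S ⊆ B) → B ∈ good)
    (U : Finset (Fin n)) (hU : U.card = m) :
    c * ((((G.filter fun e => e ⊆ U).card : ℝ) - (𝒮.filter fun S => vertsHG S ⊆ U).card) - T)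
        * T ^ (H.card - 1) / M
      ≤ ((good.filter fun B => vertsHG B ⊆ U).card : ℝ) := by
  classical
  choose! pick hpick using h𝒮
  set GU := G.filter fun e => e ⊆ U
  set SU := 𝒮.filter fun S => vertsHG S ⊆ U with hSU
  set R := GU \ SU.image pick with hR
  have hRG : R ⊆ G := sdiff_subset.trans (filter_subset _ _)
  have hRU : ∀ e ∈ R, e ⊆ U := fun e he =>
    (mem_filter.1 (show e ∈ G.filter (· ⊆ U) from (mem_sdiff.1 he).1)).2
  have hcard : (GU.card : ℝ) - SU.card ≤ R.card := by
    have h1 : GU.card ≤ R.card + SU.card := by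
      have h2 := le_card_sdiff (SU.image pick) GU
      rw [← hR] at h2
      have := card_image_le (s := SU) (f := pick)
      omega
    rw [sub_le_iff_le_add]
    exact_mod_cast h1
  rcases le_or_gt ((GU.card : ℝ) - SU.card) T with hle | hlt
  · refine le_trans ?_ (Nat.cast_nonneg _)
    refine div_nonpos_of_nonpos_of_nonneg ?_ hM.le
    exact mul_nonpos_of_nonpos_of_nonneg
      (mul_nonpos_of_nonneg_of_nonpos hc.le (by linarith)) (by positivity)
  have hRT : T < R.card := hlt.trans_le hcard
  obtain ⟨G', hG'u, hG'c, hG'n⟩ := exists_pullback H (r := 2) (G := R)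
    (fun e he => hG e (hRG he)) (U.orderEmbOfFin hU) (U.orderEmbOfFin hU).injective
    (fun e he => by
      rw [range_orderEmbOfFin]
      exact_mod_cast hRU e he)
  have hsub : copies H R ⊆ ((good.filter fun B => vertsHG B ⊆ U : Finset _) : Set _) := by
    intro B hB
    have hBR : B ⊆ R := hB.choose_spec.2.2
    have hBU : vertsHG B ⊆ U := vertsHG_subset_iff.2 fun e he => hRU e (hBR he)
    rw [mem_coe, mem_filter]
    refine ⟨hgood B (IsCopy.mono hB hRG) fun S hS hSB => ?_, hBU⟩
    have h1 : pick S ∈ R := hBR (hSB (hpick S hS))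
    exact (mem_sdiff.1 h1).2
      (mem_image_of_mem _ (mem_filter.2 ⟨hS, (vertsHG_mono hSB).trans hBU⟩))
  have hle : (copies H R).ncard ≤ (good.filter fun B => vertsHG B ⊆ U).card := by
    rw [← Set.ncard_coe_finset]
    exact Set.ncard_le_ncard hsub (Finset.finite_toSet _)
  have hmain := hcount G' hG'u (by rw [hG'c]; exact hRT)
  rw [hG'c] at hmain
  have hpow : (GU.card - SU.card - T) * T ^ (H.card - 1) ≤ (R.card : ℝ) ^ H.card := by
    obtain ⟨ℓ, hℓ⟩ := Nat.exists_eq_succ_of_ne_zero (card_pos.2 hH).ne'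
    rw [hℓ, Nat.succ_sub_one, pow_succ, mul_comm]
    gcongr
    linarith
  calc _ = c * ((GU.card - SU.card - T) * T ^ (H.card - 1)) / M := by ring
    _ ≤ c * (R.card : ℝ) ^ H.card / M := by gcongr
    _ ≤ _ := hmain.trans (by exact_mod_cast hG'n.trans hle)

/-- If the members of `𝒮` are few, weighted by the probability of surviving in a random
`m`-subset, then many copies of `H` contain no member of `𝒮`. -/
theorem card_good_copies {h n m : ℕ} (H : Finset (Finset (Fin h))) (hH : H.Nonempty)
    (hcov : ∀ v : Fin h, ∃ e ∈ H, v ∈ e) (hm : 2 ≤ m) (hmn : m ≤ n)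
    {c T : ℝ} (hc : 0 < c)
    (hcount : ∀ G' : Finset (Finset (Fin m)), UniformHG 2 G' → T < (G'.card : ℝ) →
      c * (G'.card : ℝ) ^ H.card / (m : ℝ) ^ ((2 * H.card : ℝ) - (h : ℝ)) ≤
        ((copies H G').ncard : ℝ))
    (G : Finset (Finset (Fin n))) (hG : UniformHG 2 G)
    (hT : T ≤ (m / n : ℝ) ^ 2 * G.card / 4)
    (𝒮 : Finset (Finset (Finset (Fin n)))) (h𝒮 : ∀ S ∈ 𝒮, S.Nonempty ∧ S ⊆ G)
    (hsum : ∑ S ∈ 𝒮, (m / n : ℝ) ^ ((vertsHG S).card - 2) ≤ (G.card : ℝ) / 4)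
    (good : Finset (Finset (Finset (Fin n))))
    (hgood : ∀ B, B ∈ good ↔ IsCopy H G B ∧ ∀ S ∈ 𝒮, ¬ S ⊆ B) :
    c / (8 * 4 ^ (H.card - 1)) * (G.card : ℝ) ^ H.card / (n : ℝ) ^ ((2 * H.card : ℝ) - (h : ℝ))
      ≤ (good.card : ℝ) := by
  have hm0 : (0 : ℝ) < m := by exact_mod_cast (by omega : 0 < m)
  have hn0 : (0 : ℝ) < n := by exact_mod_cast (by omega : 0 < n)
  have hrpow : ∀ x : ℝ, 0 < x → x ^ ((2 * H.card : ℝ) - (h : ℝ)) = x ^ (2 * H.card) / x ^ h := by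
    intro x hx
    rw [Real.rpow_sub hx, Real.rpow_natCast, ← Real.rpow_natCast x (2 * H.card)]
    push_cast
    rfl
  set M : ℝ := (m : ℝ) ^ ((2 * H.card : ℝ) - (h : ℝ)) with hMdef
  have hM : 0 < M := Real.rpow_pos_of_pos hm0 _
  set q : ℝ := m / n with hq
  have hq0 : 0 < q := div_pos hm0 hn0
  set e : ℝ := (G.card : ℝ) with he
  have he0 : 0 ≤ e := Nat.cast_nonneg _
  set τ : ℝ := q ^ 2 * e / 4 with hτ
  have hτ0 : 0 ≤ τ := by positivity
  set w : ℕ → ℝ := fun v => supersetCount n m v with hw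
  have hw0 : 0 < w 0 := by
    simp only [hw, supersetCount, Nat.zero_le, if_true, Nat.sub_zero]
    exact_mod_cast Nat.choose_pos hmn
  have hw2 : q ^ 2 / 2 * w 0 ≤ w 2 := le_supersetCount_two hm hmn
  have hinside : ∀ U ∈ powersetCard m (univ : Finset (Fin n)), _ := fun U hU =>
    card_good_copies_inside H hH hc hτ0 hM
      (fun G' hG' hlt => hcount G' hG' (hT.trans_lt hlt)) G hG 𝒮 (fun S hS => (h𝒮 S hS).1) good
      (fun B h1 h2 => (hgood B).2 ⟨h1, h2⟩) U (mem_powersetCard.1 hU).2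
  have hsumU := sum_le_sum hinside
  rw [← sum_div, ← sum_mul, ← mul_sum, sum_sub_distrib, sum_sub_distrib, sum_const,
    card_powersetCard, nsmul_eq_mul] at hsumU
  have hE : ∑ U ∈ powersetCard m (univ : Finset (Fin n)),
      ((G.filter fun e => e ⊆ U).card : ℝ) = e * w 2 := by
    simp only [hw, he]
    exact_mod_cast sum_card_filter_edge_subset m G hG
  have hSs : ∑ U ∈ powersetCard m (univ : Finset (Fin n)),
      ((𝒮.filter fun S => vertsHG S ⊆ U).card : ℝ) ≤ e / 4 * w 2 := by
    have h1 : ∑ U ∈ powersetCard m (univ : Finset (Fin n)),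
      ((𝒮.filter fun S => vertsHG S ⊆ U).card : ℝ) = ∑ S ∈ 𝒮, w (vertsHG S).card := by
      simp only [hw]
      exact_mod_cast sum_card_filter_vertsHG_subset m 𝒮
    rw [h1]
    calc ∑ S ∈ 𝒮, w (vertsHG S).card ≤ ∑ S ∈ 𝒮, q ^ ((vertsHG S).card - 2) * w 2 := by
          refine sum_le_sum fun S hS => ?_
          have h2 := two_le_card_vertsHG hG (h𝒮 S hS).2 (h𝒮 S hS).1
          have h3 : (vertsHG S).card ≤ n := by simpa using card_le_univ (vertsHG S)
          have := supersetCount_add_le (v := 2) hmn ((vertsHG S).card - 2) (by omega)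
          rwa [Nat.add_sub_cancel' h2] at this
      _ = (∑ S ∈ 𝒮, q ^ ((vertsHG S).card - 2)) * w 2 := by rw [sum_mul]
      _ ≤ e / 4 * w 2 := by gcongr
  have hgs : ∑ U ∈ powersetCard m (univ : Finset (Fin n)),
      ((good.filter fun B => vertsHG B ⊆ U).card : ℝ) ≤ good.card * (q ^ h * w 0) := by
    have h1 : ∑ U ∈ powersetCard m (univ : Finset (Fin n)),
      ((good.filter fun B => vertsHG B ⊆ U).card : ℝ) = ∑ S ∈ good, w (vertsHG S).card := by
      simp only [hw]
      exact_mod_cast sum_card_filter_vertsHG_subset m good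
    rw [h1, ← nsmul_eq_mul, ← sum_const]
    refine sum_le_sum fun B hB => ?_
    have h2 := IsCopy.card_vertsHG hcov ((hgood B).1 hB).1
    have h3 : (vertsHG B).card ≤ n := by simpa using card_le_univ (vertsHG B)
    have := supersetCount_add_le (v := 0) hmn h (by omega)
    rw [h2]
    simpa using this
  have hchoose : ((((univ : Finset (Fin n)).card.choose m : ℕ) : ℝ)) = w 0 := by
    simp [hw, supersetCount]
  rw [hE, hchoose] at hsumU
  have hX : e * q ^ 2 * w 0 / 8 ≤ e * w 2 - ∑ U ∈ powersetCard m (univ : Finset (Fin n)),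
      ((𝒮.filter fun S => vertsHG S ⊆ U).card : ℝ) - w 0 * τ := by
    have : e * (q ^ 2 / 2 * w 0) ≤ e * w 2 := by gcongr
    rw [hτ]
    nlinarith
  have hfin : c * (e * q ^ 2 * w 0 / 8) * τ ^ (H.card - 1) / M ≤ good.card * (q ^ h * w 0) := by
    refine le_trans ?_ (hsumU.trans hgs)
    gcongr
  obtain ⟨ℓ, hℓ⟩ := Nat.exists_eq_succ_of_ne_zero (card_pos.2 hH).ne'
  rw [hrpow n hn0, div_le_iff₀ (by positivity)]
  rw [hMdef, hrpow m hm0, div_le_iff₀ (by positivity)] at hfin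
  rw [hℓ] at hfin ⊢
  simp only [Nat.succ_eq_add_one, Nat.add_sub_cancel] at hfin ⊢
  have hL : c * (e * q ^ 2 * w 0 / 8) * τ ^ ℓ
      = (c / (8 * 4 ^ ℓ) * e ^ (ℓ + 1)) * (w 0 * q ^ (2 * (ℓ + 1))) := by
    rw [hτ, div_pow (q ^ 2 * e), mul_pow (q ^ 2), ← pow_mul]
    field_simp
    ring
  have hRr : good.card * (q ^ h * w 0) * ((m : ℝ) ^ (2 * (ℓ + 1)) / m ^ h)
      = (good.card * ((n : ℝ) ^ (2 * (ℓ + 1)) / n ^ h)) * (w 0 * q ^ (2 * (ℓ + 1))) := by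
    rw [hq, div_pow, div_pow]
    field_simp
  rw [hL, hRr] at hfin
  exact le_of_mul_le_mul_right hfin (by positivity)

/-- The nonempty sets of fewer than `ℓ` edges whose degree in `𝓗` cannot be increased
without exceeding the threshold `Δ`. -/
noncomputable def saturated {n : ℕ} (ℓ : ℕ) (Δ : ℕ → ℝ) (𝓗 : Finset (Finset (Finset (Fin n)))) :
    Finset (Finset (Finset (Fin n))) := by
  classical
  exact univ.filter fun S => 1 ≤ S.card ∧ S.card < ℓ ∧ Δ S.card < degF 𝓗 S + 1

theorem mem_saturated {n ℓ : ℕ} {Δ : ℕ → ℝ} {𝓗 : Finset (Finset (Finset (Fin n)))}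
    {S : Finset (Finset (Fin n))} :
    S ∈ saturated ℓ Δ 𝓗 ↔ 1 ≤ S.card ∧ S.card < ℓ ∧ Δ S.card < degF 𝓗 S + 1 := by
  simp [saturated]

theorem one_le_degF_of_mem_saturated {n ℓ : ℕ} {Δ : ℕ → ℝ}
    (hΔ : ∀ s, 1 ≤ s → s ≤ ℓ → 1 ≤ Δ s) {𝓗 : Finset (Finset (Finset (Fin n)))}
    {S : Finset (Finset (Fin n))} (hS : S ∈ saturated ℓ Δ 𝓗) : 1 ≤ degF 𝓗 S := by
  obtain ⟨h1, h2, h3⟩ := mem_saturated.1 hS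
  have := (hΔ _ h1 h2.le).trans_lt h3
  by_contra h
  rw [Nat.lt_one_iff.1 (not_le.1 h)] at this
  norm_num at this

theorem exists_superset_of_one_le_degF {W : Type*} [DecidableEq W]
    {𝓗 : Finset (Finset (Finset W))} {S : Finset (Finset W)} (h : 1 ≤ degF 𝓗 S) :
    ∃ B ∈ 𝓗, S ⊆ B := by
  obtain ⟨B, hB⟩ := card_pos.1 h
  exact ⟨B, (mem_filter.1 hB).1, (mem_filter.1 hB).2⟩

theorem sum_degF_le {n ℓ : ℕ} (𝓗 𝒮 : Finset (Finset (Finset (Fin n))))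
    (h𝓗 : ∀ B ∈ 𝓗, B.card = ℓ) : ∑ S ∈ 𝒮, degF 𝓗 S ≤ 𝓗.card * 2 ^ ℓ := by
  have := sum_card_bipartiteAbove_eq_sum_card_bipartiteBelow
    (s := 𝒮) (t := 𝓗) (fun S B => S ⊆ B)
  simp only [bipartiteAbove, bipartiteBelow] at this
  unfold degF
  rw [this, ← smul_eq_mul, ← sum_const]
  refine sum_le_sum fun B hB => ?_
  rw [← h𝓗 B hB, ← card_powerset]
  exact card_le_card fun S hS => mem_powerset.2 (mem_filter.1 hS).2

theorem sum_saturated_le {n ℓ : ℕ} {Δ : ℕ → ℝ} (hΔ : ∀ s, 1 ≤ s → s ≤ ℓ → 1 ≤ Δ s)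
    {𝓗 : Finset (Finset (Finset (Fin n)))} (h𝓗 : ∀ B ∈ 𝓗, B.card = ℓ) {N κ : ℝ}
    (hκ : 0 ≤ κ) (hN : (𝓗.card : ℝ) ≤ N) (wt : Finset (Finset (Fin n)) → ℝ)
    (hwt : ∀ S ∈ saturated ℓ Δ 𝓗, wt S ≤ κ * Δ S.card) :
    ∑ S ∈ saturated ℓ Δ 𝓗, wt S ≤ 2 * κ * (N * 2 ^ ℓ) := by
  calc ∑ S ∈ saturated ℓ Δ 𝓗, wt S ≤ ∑ S ∈ saturated ℓ Δ 𝓗, 2 * κ * (degF 𝓗 S : ℝ) := by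
        refine sum_le_sum fun S hS => (hwt S hS).trans ?_
        have h1 : (1 : ℝ) ≤ degF 𝓗 S := by exact_mod_cast one_le_degF_of_mem_saturated hΔ hS
        have h2 := (mem_saturated.1 hS).2.2
        nlinarith
    _ = 2 * κ * ((∑ S ∈ saturated ℓ Δ 𝓗, degF 𝓗 S : ℕ) : ℝ) := by
        rw [← mul_sum]
        push_cast
        rfl
    _ ≤ 2 * κ * (((𝓗.card * 2 ^ ℓ : ℕ)) : ℝ) := by
        gcongr
        exact sum_degF_le 𝓗 _ h𝓗
    _ ≤ 2 * κ * (N * 2 ^ ℓ) := by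
        push_cast
        gcongr

/-- Greedy construction: if at every stage there are at least `N` copies avoiding the saturated
sets, then a family of at least `N` copies with degrees bounded by `Δ` exists. -/
theorem exists_balanced_family {h n : ℕ} (H : Finset (Finset (Fin h)))
    (G : Finset (Finset (Fin n))) (Δ : ℕ → ℝ) (hΔ : ∀ s, 1 ≤ s → s ≤ H.card → 1 ≤ Δ s) (N : ℝ)
    (hgood : ∀ 𝓗 : Finset (Finset (Finset (Fin n))), (∀ B ∈ 𝓗, IsCopy H G B) →
      (𝓗.card : ℝ) < N → ∀ good : Finset (Finset (Finset (Fin n))),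
      (∀ B, B ∈ good ↔ IsCopy H G B ∧ ∀ S ∈ saturated H.card Δ 𝓗, ¬ S ⊆ B) →
      N ≤ (good.card : ℝ)) :
    ∃ 𝓗 : Finset (Finset (Finset (Fin n))), (∀ B ∈ 𝓗, IsCopy H G B) ∧ N ≤ (𝓗.card : ℝ) ∧
      ∀ S : Finset (Finset (Fin n)), 1 ≤ S.card → S.card ≤ H.card →
        (degF 𝓗 S : ℝ) ≤ Δ S.card := by
  classical
  obtain ⟨𝓗, hmem, hmax⟩ := exists_max_image
    (univ.filter fun 𝓗 : Finset (Finset (Finset (Fin n))) => (∀ B ∈ 𝓗, IsCopy H G B) ∧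
      ∀ S : Finset (Finset (Fin n)), 1 ≤ S.card → S.card ≤ H.card →
        (degF 𝓗 S : ℝ) ≤ Δ S.card) card
    ⟨∅, mem_filter.2 ⟨mem_univ _, by simp, fun S h1 h2 => by
      simpa [degF] using zero_le_one.trans (hΔ _ h1 h2)⟩⟩
  obtain ⟨hcop, hdeg⟩ := (mem_filter.1 hmem).2
  refine ⟨𝓗, hcop, ?_, hdeg⟩
  by_contra! hlt
  set good := univ.filter fun B => IsCopy H G B ∧ ∀ S ∈ saturated H.card Δ 𝓗, ¬ S ⊆ B with hg
  have hN := hgood 𝓗 hcop hlt good (by simp [hg])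
  obtain ⟨B, hBg, hB⟩ : ∃ B ∈ good, B ∉ 𝓗 := by
    by_contra! hcon
    have : (good.card : ℝ) ≤ 𝓗.card := by exact_mod_cast card_le_card hcon
    linarith
  obtain ⟨hBc, hBs⟩ := (mem_filter.1 hBg).2
  have hvalid : ∀ S : Finset (Finset (Fin n)), 1 ≤ S.card → S.card ≤ H.card →
      (degF (insert B 𝓗) S : ℝ) ≤ Δ S.card := by
    intro S h1 h2
    by_cases hSB : S ⊆ B
    · have hd : degF (insert B 𝓗) S ≤ degF 𝓗 S + 1 := by
        unfold degF
        rw [filter_insert, if_pos hSB]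
        exact card_insert_le _ _
      have hd' : (degF (insert B 𝓗) S : ℝ) ≤ degF 𝓗 S + 1 := by exact_mod_cast hd
      rcases h2.lt_or_eq with h3 | h3
      · refine hd'.trans ?_
        by_contra! hcon
        exact hBs S (mem_saturated.2 ⟨h1, h3, hcon⟩) hSB
      · have hSeq : S = B := eq_of_subset_of_card_le hSB (by rw [hBc.card_eq, h3])
        have hz : degF 𝓗 S = 0 := by
          by_contra hne
          obtain ⟨B', hB', hsub⟩ := exists_superset_of_one_le_degF (Nat.one_le_iff_ne_zero.2 hne)
          have : S = B' := eq_of_subset_of_card_le hsub (by rw [(hcop B' hB').card_eq, h3])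
          exact hB (hSeq ▸ this ▸ hB')
        rw [hz] at hd'
        exact hd'.trans (by simpa using hΔ _ h1 h2)
    · have : degF (insert B 𝓗) S = degF 𝓗 S := by
        unfold degF
        rw [filter_insert, if_neg hSB]
      rw [this]
      exact hdeg S h1 h2
  have := hmax (insert B 𝓗) (mem_filter.2 ⟨mem_univ _, fun B' hB' => by
    rcases mem_insert.1 hB' with rfl | h
    · exact hBc
    · exact hcop _ h, hvalid⟩)
  rw [card_insert_of_notMem hB] at this
  omega

theorem le_mDen {V : Type*} [DecidableEq V] {r : ℕ} {H F : Finset (Finset V)} (hF : F ⊆ H)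
    (hr : r < (vertsHG F).card) :
    ((F.card : ℝ) - 1) / (((vertsHG F).card : ℝ) - (r : ℝ)) ≤ mDen r H := by
  refine le_csSup (Set.Finite.bddAbove ?_) ⟨F, hF, hr, rfl⟩
  refine (H.powerset.finite_toSet.image fun F =>
    ((F.card : ℝ) - 1) / (((vertsHG F).card : ℝ) - (r : ℝ))).subset ?_
  rintro x ⟨F, hF, -, rfl⟩
  exact ⟨F, mem_coe.2 (mem_powerset.2 hF), rfl⟩

theorem le_mDenStar {V : Type*} [DecidableEq V] {r : ℕ} {H F : Finset (Finset V)} (hF : F ⊂ H)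
    (hr : r < (vertsHG F).card) :
    ((F.card : ℝ) - 1) / (((vertsHG F).card : ℝ) - (r : ℝ)) ≤ mDenStar r H := by
  refine le_csSup (Set.Finite.bddAbove ?_) ⟨F, hF, hr, rfl⟩
  refine (H.powerset.finite_toSet.image fun F =>
    ((F.card : ℝ) - 1) / (((vertsHG F).card : ℝ) - (r : ℝ))).subset ?_
  rintro x ⟨F, hF, -, rfl⟩
  exact ⟨F, mem_coe.2 (mem_powerset.2 hF.subset), rfl⟩

theorem two_le_card_of_mDen_pos {h : ℕ} {H : Finset (Finset (Fin h))} (hHu : UniformHG 2 H)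
    (hpos : 0 < mDen 2 H) : 2 ≤ H.card ∧ 3 ≤ h := by
  have hne : ∃ F, F ⊆ H ∧ 2 < (vertsHG F).card := by
    by_contra! hcon
    have : mDen 2 H = 0 := by
      unfold mDen
      convert Real.sSup_empty
      rw [Set.eq_empty_iff_forall_notMem]
      rintro x ⟨F, hF, h2, -⟩
      exact absurd h2 (not_lt.2 (hcon F hF))
    exact hpos.ne' this
  obtain ⟨F, hF, h2⟩ := hne
  have h1 : (vertsHG F).card ≤ F.card * 2 :=
    card_biUnion_le_card_mul _ _ _ fun e he => (hHu e (hF he)).le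
  have h3 : (vertsHG F).card ≤ h := by simpa using card_le_univ (vertsHG F)
  have h4 := card_le_card hF
  omega

theorem phiHG_nonneg {h : ℕ} {H : Finset (Finset (Fin h))} (hHu : UniformHG 2 H)
    (hcov : ∀ v : Fin h, ∃ e ∈ H, v ∈ e) {α : ℝ} (hpos : 0 < mDen 2 H)
    (hα : 2 - 1 / mDen 2 H < α) : 0 ≤ phiHG α h H.card := by
  obtain ⟨hℓ, hh⟩ := two_le_card_of_mDen_pos hHu hpos
  have hverts : (vertsHG H).card = h := by
    have : vertsHG H = univ := by
      ext v
      simpa [vertsHG] using hcov v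
    rw [this, card_univ, Fintype.card_fin]
  have hden := le_mDen (r := 2) (Subset.refl H) (by omega)
  rw [hverts] at hden
  have hℓ' : (2 : ℝ) ≤ H.card := by exact_mod_cast hℓ
  have hh' : (3 : ℝ) ≤ h := by exact_mod_cast hh
  push_cast at hden
  have h1 : 1 / mDen 2 H ≤ ((h : ℝ) - 2) / (H.card - 1) := by
    rw [div_le_div_iff₀ hpos (by linarith)]
    rw [div_le_iff₀ (by linarith)] at hden
    linarith
  have h2 : 2 - ((h : ℝ) - 2) / (H.card - 1) < α := by linarith
  rw [sub_lt_iff_lt_add, ← sub_lt_iff_lt_add', lt_div_iff₀ (by linarith)] at h2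
  unfold phiHG
  exact div_nonneg (by nlinarith) (by linarith)

theorem UniformHG.card_le_sq {n : ℕ} {G : Finset (Finset (Fin n))} (hG : UniformHG 2 G) :
    (G.card : ℝ) ≤ (n : ℝ) ^ 2 := by
  have h1 : G ⊆ powersetCard 2 univ := fun e he => mem_powersetCard.2 ⟨subset_univ _, hG e he⟩
  have h2 := (card_le_card h1).trans_eq (card_powersetCard 2 univ)
  rw [card_univ, Fintype.card_fin] at h2
  exact_mod_cast h2.trans (Nat.choose_le_pow n 2)

/-- The sampling weight `y⁻¹ ^ (v(S) - 2)` of a proper subset `S` of a copy of `H` is bounded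
through the density of proper subgraphs of `H`. -/
theorem inv_pow_le_codegree_ratio {h n : ℕ} {H : Finset (Finset (Fin h))}
    {G S B : Finset (Finset (Fin n))} (hG : UniformHG 2 G) (hB : IsCopy H G B) (hSB : S ⊆ B)
    (hS1 : 1 ≤ S.card) (hSH : S.card < H.card) {α k y β : ℝ} (hα : α < 2)
    (hy : 1 ≤ y) (hyk : y ^ (2 - α) = k) (hβ : k ^ (-(lamStarHG 2 α H)) ≤ β) :
    (y⁻¹) ^ ((vertsHG S).card - 2) ≤ β ^ (S.card - 1) := by
  have hy0 : 0 < y := by linarith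
  have hSG : S ⊆ G := hSB.trans hB.choose_spec.2.2
  have hv2 := two_le_card_vertsHG hG hSG (card_pos.1 hS1)
  rcases hS1.eq_or_lt with h1 | h1
  · rw [← h1]
    simpa using pow_le_one₀ (by positivity) (inv_le_one_of_one_le₀ hy)
  have hv3 : 2 < (vertsHG S).card := by
    by_contra hcon
    have hsub : S ⊆ {vertsHG S} := by
      intro e he
      rw [mem_singleton]
      exact eq_of_subset_of_card_le (vertsHG_subset_iff.1 (Subset.refl (vertsHG S)) e he)
        (by rw [hG e (hSG he)]; omega)
    have := card_le_card hsub
    rw [card_singleton] at this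
    omega
  obtain ⟨F, hFH, hFc, hFv⟩ := hB.exists_subset hSB
  have hFss : F ⊂ H := hFH.ssubset_of_ne (by rintro rfl; omega)
  have hden := le_mDenStar (r := 2) hFss (by omega)
  rw [hFc, hFv] at hden
  set μ := mDenStar 2 H with hμ
  have hs : (1 : ℝ) < S.card := by exact_mod_cast h1
  have hv : (2 : ℝ) < (vertsHG S).card := by exact_mod_cast hv3
  push_cast at hden
  have hμ0 : 0 < μ := lt_of_lt_of_le (div_pos (by linarith) (by linarith)) hden
  have hk : k ^ (-(lamStarHG 2 α H)) = y ^ (-(1 / μ)) := by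
    rw [← hyk, ← Real.rpow_mul hy0.le]
    congr 1
    have : 2 - α ≠ 0 := by linarith
    simp only [lamStarHG, ← hμ]
    push_cast
    field_simp
  rw [hk] at hβ
  rw [div_le_iff₀ (by linarith)] at hden
  calc (y⁻¹) ^ ((vertsHG S).card - 2) = y ^ (-(((vertsHG S).card : ℝ) - 2)) := by
        rw [Real.rpow_neg hy0.le, inv_pow, ← Real.rpow_natCast y, Nat.cast_sub hv2]
        norm_num
    _ ≤ y ^ (-(1 / μ) * ((S.card - 1 : ℕ) : ℝ)) := by
        refine Real.rpow_le_rpow_of_exponent_le hy ?_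
        rw [Nat.cast_sub hS1, neg_mul, neg_le_neg_iff, one_div_mul_eq_div, div_le_iff₀ hμ0]
        push_cast
        linarith
    _ = (y ^ (-(1 / μ))) ^ (S.card - 1) := by rw [Real.rpow_mul hy0.le, Real.rpow_natCast]
    _ ≤ β ^ (S.card - 1) := by gcongr

/-- The threshold `β^(s-1) e^ℓ / n^(2ℓ-h) / e` is at least one. -/
theorem one_le_threshold {n h ℓ s : ℕ} (hℓ : 2 ≤ ℓ) (hs : s ≤ ℓ) {α k β e : ℝ}
    (hn : 1 ≤ (n : ℝ)) (hk : 1 ≤ k) (he : e = k * (n : ℝ) ^ α) (hφ : 0 ≤ phiHG α h ℓ)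
    (hβ : (1 / k) * (n : ℝ) ^ (-(phiHG α h ℓ)) ≤ β) :
    1 ≤ β ^ (s - 1) * (e ^ ℓ / (n : ℝ) ^ (2 * (ℓ : ℝ) - (h : ℝ))) / e := by
  have hn0 : (0 : ℝ) < n := by linarith
  have hk0 : 0 < k := by linarith
  have he0 : 0 < e := by rw [he]; positivity
  set β₀ := (1 / k) * (n : ℝ) ^ (-(phiHG α h ℓ)) with hβ₀
  have hβ₀0 : 0 < β₀ := by positivity
  have hβ₀1 : β₀ ≤ 1 := by
    refine mul_le_one₀ ?_ (by positivity) ?_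
    · rw [div_le_one hk0]
      exact hk
    · exact Real.rpow_le_one_of_one_le_of_nonpos hn (by linarith)
  have hid : β₀ ^ (ℓ - 1) * e ^ (ℓ - 1) = (n : ℝ) ^ (2 * (ℓ : ℝ) - (h : ℝ)) := by
    rw [← mul_pow, hβ₀, he, show 1 / k * (n : ℝ) ^ (-(phiHG α h ℓ)) * (k * (n : ℝ) ^ α)
      = (n : ℝ) ^ (-(phiHG α h ℓ)) * (n : ℝ) ^ α by field_simp, ← Real.rpow_add hn0,
      ← Real.rpow_natCast, ← Real.rpow_mul hn0.le]
    congr 1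
    have hℓ' : (2 : ℝ) ≤ ℓ := by exact_mod_cast hℓ
    have : (ℓ : ℝ) - 1 ≠ 0 := by linarith
    rw [Nat.cast_sub (by omega)]
    unfold phiHG
    push_cast
    field_simp
    ring
  have hpow : β₀ ^ (ℓ - 1) ≤ β ^ (s - 1) :=
    (pow_le_pow_of_le_one hβ₀0.le hβ₀1 (show s - 1 ≤ ℓ - 1 by omega)).trans
      (pow_le_pow_left₀ hβ₀0.le hβ _)
  have hM : 0 < (n : ℝ) ^ (2 * (ℓ : ℝ) - (h : ℝ)) := by positivity
  calc (1 : ℝ) = β₀ ^ (ℓ - 1) * (e ^ ℓ / (n : ℝ) ^ (2 * (ℓ : ℝ) - (h : ℝ))) / e := by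
        rw [eq_div_iff he0.ne', ← mul_div_assoc, eq_div_iff hM.ne', ← hid]
        obtain ⟨j, rfl⟩ := Nat.exists_eq_add_of_le' (by omega : 1 ≤ ℓ)
        rw [Nat.add_sub_cancel]
        ring
    _ ≤ _ := by gcongr

/-- The sum of the weights of the saturated sets, once all parameters are inserted. -/
theorem two_mul_weight_le {C D e P N : ℝ} (hC0 : 0 < C) (he0 : 0 ≤ e) (hN : 0 < N)
    (hCD : 8 * P * D ≤ C) : 2 * (D * e / (C * N)) * (N * P) ≤ e / 4 := by
  rw [show 2 * (D * e / (C * N)) * (N * P) = 2 * P * D * e / C by field_simp,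
    div_le_div_iff₀ hC0 four_pos]
  nlinarith

set_option maxHeartbeats 1000000 in
/-- Balanced supersaturation for Erdős–Simonovits good bipartite graphs:
the family can be taken of the conjectured optimal size `δ_H·e(G)^ℓ/n^(2ℓ−h)`, with
codegree ratio `β = max{(1/k)·n^(−φ(α,H)), k^(−λ*(α,H))}`. -/
theorem balanced_supersaturation_ESgood {h ℓ : ℕ}
    (H : Finset (Finset (Fin h))) (hHu : UniformHG 2 H) (hHp : MultipartiteHG 2 H)
    (hcov : ∀ v : Fin h, ∃ e ∈ H, v ∈ e) (hHe : H.card = ℓ)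
    (α A : ℝ) (hES : ESGood H α) (hα0 : 0 < α) (hA0 : 0 < A) (hA : (16 : ℝ) ≤ A)
    (hαlow : 2 - 1 / mDen 2 H < α)
    (hex : ∀ n : ℕ, (exN 2 H n : ℝ) ≤ A * (n : ℝ) ^ α) :
    ∃ δH k₀ C : ℝ, 0 < δH ∧ 0 < k₀ ∧ 0 < C ∧
      ∀ (n : ℕ) (k : ℝ) (G : Finset (Finset (Fin n))),
        UniformHG 2 G → k₀ ≤ k → (G.card : ℝ) = k * (n : ℝ) ^ α →
        ∃ 𝓗 : Finset (Finset (Finset (Fin n))),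
          (∀ B ∈ 𝓗, IsCopy H G B) ∧
          δH * (G.card : ℝ) ^ ℓ / (n : ℝ) ^ (2 * (ℓ : ℝ) - (h : ℝ)) ≤ (𝓗.card : ℝ) ∧
          ∀ S : Finset (Finset (Fin n)), S ⊆ G → 1 ≤ S.card → S.card ≤ ℓ →
            (degF 𝓗 S : ℝ) ≤
              C * (max ((1 / k) * (n : ℝ) ^ (-(phiHG α h ℓ))) (k ^ (-(lamStarHG 2 α H))))
                  ^ (S.card - 1) * (𝓗.card : ℝ) / (G.card : ℝ) := by
  classical
  subst hHe
  by_cases hα2 : 2 ≤ α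
  · refine ⟨1, 2, 1, one_pos, two_pos, one_pos, fun n k G hG hk hGk => ?_⟩
    rcases Nat.eq_zero_or_pos n with rfl | hn
    · have hG0 : G = ∅ := by
        rw [← card_eq_zero, ← Nat.cast_eq_zero (R := ℝ), hGk, Nat.cast_zero,
          Real.zero_rpow hα0.ne', mul_zero]
      subst hG0
      rcases H.eq_empty_or_nonempty with rfl | hH
      · refine ⟨{∅}, ?_, ?_, ?_⟩
        · intro B hB
          have hempty : IsEmpty (Fin h) := ⟨fun v => by simpa using hcov v⟩
          exact ⟨fun v => hempty.elim v, fun v => hempty.elim v, by simpa using hB,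
            by simp [mem_singleton.1 hB]⟩
        · have hh : h = 0 := by
            by_contra hne
            simpa using hcov ⟨0, Nat.pos_of_ne_zero hne⟩
          subst hh
          simp
        · intro S hS hS1
          rw [subset_empty.1 hS] at hS1
          simp at hS1
      · refine ⟨∅, by simp, ?_, ?_⟩
        · simp [hH.ne_empty]
        · intro S hS hS1
          rw [subset_empty.1 hS] at hS1
          simp at hS1
    · exfalso
      have hn1 : (1 : ℝ) ≤ n := by exact_mod_cast hn
      have h1 := hG.card_le_sq
      have h2 : (n : ℝ) ^ (2 : ℕ) ≤ (n : ℝ) ^ α := by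
        rw [← Real.rpow_natCast]
        exact Real.rpow_le_rpow_of_exponent_le hn1 (by exact_mod_cast hα2)
      have h3 : (0 : ℝ) < (n : ℝ) ^ (2 : ℕ) := by positivity
      nlinarith
  push Not at hα2
  have hmpos : 0 < mDen 2 H := by
    have : 0 < 1 / mDen 2 H := by linarith
    exact one_div_pos.1 this
  obtain ⟨hℓ, hh⟩ := two_le_card_of_mDen_pos hHu hmpos
  have hH : H.Nonempty := card_pos.1 (by omega)
  have hφ := phiHG_nonneg hHu hcov hmpos hαlow
  obtain ⟨C₁, c₁, hC₁, hc₁, hES⟩ := hES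
  obtain ⟨n₁, hn₁⟩ := eventually_atTop.1 hES
  have hα2' : 0 < 2 - α := by linarith
  set δ : ℝ := c₁ / (8 * 4 ^ (H.card - 1)) with hδ
  have hδ0 : 0 < δ := by positivity
  set r : ℝ := max (max (n₁ : ℝ) 2) ((4 * C₁) ^ (1 / (2 - α))) with hr
  have hrn : (n₁ : ℝ) ≤ r := (le_max_left _ _).trans (le_max_left _ _)
  have hr2 : (2 : ℝ) ≤ r := (le_max_right _ _).trans (le_max_left _ _)
  have hrC : 4 * C₁ ≤ r ^ (2 - α) := by
    calc 4 * C₁ = ((4 * C₁) ^ (1 / (2 - α))) ^ (2 - α) := by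
          rw [← Real.rpow_mul (by positivity), one_div_mul_cancel hα2'.ne', Real.rpow_one]
      _ ≤ r ^ (2 - α) := Real.rpow_le_rpow (by positivity) (le_max_right _ _) hα2'.le
  have hr0 : 0 < r := by linarith
  set D : ℝ := (2 * r) ^ h with hD
  have hD0 : 0 < D := by positivity
  set C : ℝ := max (8 * 2 ^ H.card * D) (1 / δ) with hC
  have hCD : 8 * 2 ^ H.card * D ≤ C := le_max_left _ _
  have hCδ : 1 / δ ≤ C := le_max_right _ _
  have hC0 : 0 < C := lt_of_lt_of_le (by positivity) hCδ
  refine ⟨δ, r ^ (2 - α), C, hδ0, by positivity, hC0, fun n k G hG hk hGk => ?_⟩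
  rcases Nat.eq_zero_or_pos n with rfl | hn
  · have hG0 : G = ∅ := by
      rw [← card_eq_zero, ← Nat.cast_eq_zero (R := ℝ), hGk, Nat.cast_zero,
        Real.zero_rpow hα0.ne', mul_zero]
    subst hG0
    refine ⟨∅, by simp, ?_, ?_⟩
    · simp [hH.ne_empty]
    · intro S hS hS1
      rw [subset_empty.1 hS] at hS1
      simp at hS1
  have hn1 : (1 : ℝ) ≤ n := by exact_mod_cast hn
  have hn0 : (0 : ℝ) < n := by linarith
  have hk1 : 1 ≤ k := (Real.one_le_rpow (by linarith) hα2'.le).trans hk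
  have hk0 : 0 < k := by linarith
  set y : ℝ := k ^ (1 / (2 - α)) with hy
  have hyk : y ^ (2 - α) = k := by
    rw [hy, ← Real.rpow_mul hk0.le, one_div_mul_cancel hα2'.ne', Real.rpow_one]
  have hy0 : 0 < y := by positivity
  have hry : r ≤ y := by
    rw [← Real.rpow_le_rpow_iff hr0.le hy0.le hα2', hyk]
    exact hk
  have hyn : y ≤ n := by
    rw [← Real.rpow_le_rpow_iff hy0.le hn0.le hα2', hyk, Real.rpow_sub hn0,
      le_div_iff₀ (by positivity), ← hGk]
    exact_mod_cast hG.card_le_sq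
  set e : ℝ := (G.card : ℝ) with he
  have he0 : 0 < e := by rw [hGk]; positivity
  set p : ℝ := r * n / y with hp
  have hp_le : p ≤ n := by
    rw [hp, div_le_iff₀ hy0]
    nlinarith
  have hrp : r ≤ p := by
    rw [hp, le_div_iff₀ hy0]
    nlinarith
  set m : ℕ := ⌈p⌉₊ with hm
  have hpm : p ≤ m := Nat.le_ceil p
  have hm2p : (m : ℝ) ≤ 2 * p := by
    have := Nat.ceil_lt_add_one (show 0 ≤ p by linarith)
    linarith
  have hmn : m ≤ n := Nat.ceil_le.2 hp_le
  have hm2 : 2 ≤ m := by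
    have : (2 : ℝ) ≤ m := by linarith
    exact_mod_cast this
  have hmn₁ : n₁ ≤ m := by
    have : (n₁ : ℝ) ≤ m := by linarith
    exact_mod_cast this
  have hm0 : (0 : ℝ) < m := by linarith
  have hq0 : (0 : ℝ) < m / n := by positivity
  have hq_ge : r / y ≤ m / n := by
    rw [div_le_div_iff₀ hy0 hn0, ← div_le_iff₀ hy0]
    exact hpm
  have hq_le : (m / n : ℝ) ≤ 2 * r * y⁻¹ := by
    rw [div_le_iff₀ hn0]
    calc (m : ℝ) ≤ 2 * p := hm2p
      _ = 2 * r * y⁻¹ * n := by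
        rw [hp]
        field_simp
  have hT : C₁ * (m : ℝ) ^ α ≤ (m / n : ℝ) ^ 2 * e / 4 := by
    have h1 : (m / n : ℝ) ^ 2 * e = (m / n : ℝ) ^ (2 - α) * k * (m : ℝ) ^ α := by
      rw [hGk, Real.rpow_sub hq0, Real.div_rpow hm0.le hn0.le α, ← Real.rpow_natCast]
      have := (Real.rpow_pos_of_pos hm0 α).ne'
      have := (Real.rpow_pos_of_pos hn0 α).ne'
      push_cast
      field_simp
    have h2 : r ^ (2 - α) ≤ (m / n : ℝ) ^ (2 - α) * k := by
      calc r ^ (2 - α) = (r / y) ^ (2 - α) * k := by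
            rw [Real.div_rpow hr0.le hy0.le, hyk]
            field_simp
        _ ≤ _ := by gcongr
    rw [h1, le_div_iff₀ four_pos]
    have h3 : 0 < (m : ℝ) ^ α := by positivity
    nlinarith
  set β : ℝ := max ((1 / k) * (n : ℝ) ^ (-(phiHG α h H.card))) (k ^ (-(lamStarHG 2 α H))) with hβ
  have hβ0 : 0 < β := lt_of_lt_of_le (by positivity) (le_max_left _ _)
  set Q : ℝ := e ^ H.card / (n : ℝ) ^ (2 * (H.card : ℝ) - (h : ℝ)) with hQ
  have hQ0 : 0 < Q := by positivity
  set Δ : ℕ → ℝ := fun s => C * β ^ (s - 1) * (δ * Q) / e with hΔ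
  have hΔ1 : ∀ s, 1 ≤ s → s ≤ H.card → 1 ≤ Δ s := by
    intro s _ hs
    have h1 := one_le_threshold hℓ hs hn1 hk1 hGk hφ (le_max_left _ (k ^ (-(lamStarHG 2 α H))))
    have h2 : 1 ≤ C * δ := by rwa [div_le_iff₀ hδ0] at hCδ
    calc (1 : ℝ) ≤ (C * δ) * (β ^ (s - 1) * Q / e) := one_le_mul_of_one_le_of_one_le h2 h1
      _ = Δ s := by
        simp only [hΔ]
        ring
  have hNeq : δ * e ^ H.card / (n : ℝ) ^ (2 * (H.card : ℝ) - (h : ℝ)) = δ * Q := mul_div_assoc _ _ _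
  obtain ⟨𝓗, hcop, hN, hdeg⟩ := exists_balanced_family H G Δ hΔ1 (δ * Q) (by
    intro 𝓗 hcop hlt good hgood
    have hsat : ∀ S ∈ saturated H.card Δ 𝓗, ∃ B ∈ 𝓗, S ⊆ B := fun S hS =>
      exists_superset_of_one_le_degF (one_le_degF_of_mem_saturated hΔ1 hS)
    rw [← hNeq]
    refine card_good_copies H hH hcov hm2 hmn hc₁ (hn₁ m hmn₁) G hG hT
      (saturated H.card Δ 𝓗) (fun S hS => ?_) ?_ good hgood
    · obtain ⟨B, hB, hSB⟩ := hsat S hS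
      exact ⟨card_pos.1 (mem_saturated.1 hS).1, hSB.trans (hcop B hB).choose_spec.2.2⟩
    · refine (sum_saturated_le hΔ1 (fun B hB => (hcop B hB).card_eq)
        (κ := D * e / (C * (δ * Q))) (by positivity) hlt.le _ fun S hS => ?_).trans ?_
      · obtain ⟨B, hB, hSB⟩ := hsat S hS
        obtain ⟨hS1, hSH, -⟩ := mem_saturated.1 hS
        have h1 := inv_pow_le_codegree_ratio hG (hcop B hB) hSB hS1 hSH hα2
          (by linarith : 1 ≤ y) hyk
          (le_max_right ((1 / k) * (n : ℝ) ^ (-(phiHG α h H.card))) _)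
        have hvh : (vertsHG S).card - 2 ≤ h := by
          have h3 := card_le_card (vertsHG_mono hSB)
          rw [(hcop B hB).card_vertsHG hcov] at h3
          omega
        calc (m / n : ℝ) ^ ((vertsHG S).card - 2)
            ≤ (2 * r * y⁻¹) ^ ((vertsHG S).card - 2) := by gcongr
          _ = (2 * r) ^ ((vertsHG S).card - 2) * (y⁻¹) ^ ((vertsHG S).card - 2) := mul_pow _ _ _
          _ ≤ D * β ^ (S.card - 1) := by
              refine mul_le_mul ?_ h1 (by positivity) hD0.le
              exact pow_le_pow_right₀ (by linarith) hvh
          _ = D * e / (C * (δ * Q)) * Δ S.card := by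
              simp only [hΔ]
              field_simp
      · exact two_mul_weight_le hC0 he0.le (mul_pos hδ0 hQ0) hCD)
  refine ⟨𝓗, hcop, hNeq.trans_le hN, fun S _ hS1 hS2 => (hdeg S hS1 hS2).trans ?_⟩
  simp only [hΔ]
  gcongr
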